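/- There exists a universal constant c > 0 such that the following holds. Let Δ ∈ (0, 1/4] be such that m := 1/Δ² is a positive integer, and let u ∈ [2, 1/(2Δ)]. Let X ~ Bin(m, (1−Δ)/2) and Y ~ Bin(m, (1+Δ)/2). Then (i) P(X ≥ (1+uΔ)/(2Δ²)) ≤ (2/(1+u))·exp(−m·KL(Ber((1−uΔ)/2) ‖ Ber((1+Δ)/2))), and (ii) P(Y ≥ (1+uΔ)/(2Δ²)) ≥ (c/(1+u))·exp(−m·KL(Ber((1−uΔ)/2) ‖ Ber((1−Δ)/2))). -/

import Mathlib

/-- The probability mass function of the binomial distribution `Bin(m, p)` at `j`. -/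
noncomputable def binPMF (m : ℕ) (p : ℝ) (j : ℕ) : ℝ :=
  (m.choose j : ℝ) * p ^ j * (1 - p) ^ (m - j)

/-- The Kullback–Leibler divergence `KL(Ber(q) ‖ Ber(p))` between Bernoulli distributions,
in nats. -/
noncomputable def klBer (q p : ℝ) : ℝ :=
  q * Real.log (q / p) + (1 - q) * Real.log ((1 - q) / (1 - p))

lemma klBer_one_sub (q p : ℝ) : klBer (1 - q) (1 - p) = klBer q p := by
  simp only [klBer, sub_sub_cancel]
  ring

lemma klBer_nonneg {x q : ℝ} (hx₀ : 0 < x) (hx₁ : x < 1) (hq₀ : 0 < q) (hq₁ : q < 1) :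
    0 ≤ klBer x q := by
  have h₁ := Real.one_sub_inv_le_log_of_pos (div_pos hx₀ hq₀)
  have h₂ := Real.one_sub_inv_le_log_of_pos (div_pos (sub_pos.2 hx₁) (sub_pos.2 hq₁))
  have h₃ := mul_le_mul_of_nonneg_left h₁ hx₀.le
  have h₄ := mul_le_mul_of_nonneg_left h₂ (sub_pos.2 hx₁).le
  have e₁ : x * (1 - (x / q)⁻¹) = x - q := by field_simp
  have e₂ : (1 - x) * (1 - ((1 - x) / (1 - q))⁻¹) = q - x := by
    have := (sub_pos.2 hx₁).ne'
    have := (sub_pos.2 hq₁).ne'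
    field_simp
    ring
  rw [e₁] at h₃
  rw [e₂] at h₄
  unfold klBer
  linarith

/-- The Kullback–Leibler divergence is at most the chi-squared divergence. -/
lemma klBer_le_sq_div {x q : ℝ} (hx₀ : 0 < x) (hx₁ : x < 1) (hq₀ : 0 < q) (hq₁ : q < 1) :
    klBer x q ≤ (x - q) ^ 2 / (q * (1 - q)) := by
  have hx := sub_pos.2 hx₁
  have hq := sub_pos.2 hq₁
  have h₁ := mul_le_mul_of_nonneg_left (Real.log_le_sub_one_of_pos (div_pos hx₀ hq₀)) hx₀.le
  have h₂ := mul_le_mul_of_nonneg_left (Real.log_le_sub_one_of_pos (div_pos hx hq)) hx.le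
  have e : x * (x / q - 1) + (1 - x) * ((1 - x) / (1 - q) - 1) = (x - q) ^ 2 / (q * (1 - q)) := by
    have := hq.ne'
    field_simp
    ring
  unfold klBer
  linarith

/-- The compensation identity for Bernoulli Kullback–Leibler divergences. -/
lemma klBer_eq_add {x q p : ℝ} (hx₀ : 0 < x) (hx₁ : x < 1) (hq₀ : 0 < q) (hq₁ : q < 1)
    (hp₀ : 0 < p) (hp₁ : p < 1) :
    klBer x p = klBer q p + (x - q) * Real.log (q * (1 - p) / (p * (1 - q))) + klBer x q := by
  have hx := (sub_pos.2 hx₁).ne'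
  have hq := (sub_pos.2 hq₁).ne'
  have hp := (sub_pos.2 hp₁).ne'
  unfold klBer
  rw [Real.log_div (mul_ne_zero hq₀.ne' hp) (mul_ne_zero hp₀.ne' hq), Real.log_mul hq₀.ne' hp,
    Real.log_mul hp₀.ne' hq, Real.log_div hx₀.ne' hp₀.ne', Real.log_div hx hp,
    Real.log_div hq₀.ne' hp₀.ne', Real.log_div hq hp, Real.log_div hx₀.ne' hq₀.ne',
    Real.log_div hx hq]
  ring

lemma klBer_le_of_le {x q p : ℝ} (hp₀ : 0 < p) (hpq : p ≤ q) (hqx : q ≤ x) (hx₁ : x < 1) :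
    klBer q p ≤ klBer x p := by
  have hq₀ := hp₀.trans_le hpq
  have hx₀ := hq₀.trans_le hqx
  have hq₁ := hqx.trans_lt hx₁
  have hp₁ := hpq.trans_lt hq₁
  have hlog : 0 ≤ Real.log (q * (1 - p) / (p * (1 - q))) := by
    apply Real.log_nonneg
    rw [one_le_div (mul_pos hp₀ (sub_pos.2 hq₁))]
    nlinarith
  have := mul_nonneg (sub_nonneg.2 hqx) hlog
  have := klBer_nonneg hx₀ hx₁ hq₀ hq₁
  rw [klBer_eq_add hx₀ hx₁ hq₀ hq₁ hp₀ hp₁]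
  linarith

lemma klBer_le_add {x q p : ℝ} (hp₀ : 0 < p) (hpq : p ≤ q) (hqx : q ≤ x) (hx₁ : x < 1) :
    klBer x p ≤ klBer q p + (x - q) * ((q - p) / (p * (1 - q))) +
      (x - q) ^ 2 / (q * (1 - q)) := by
  have hq₀ := hp₀.trans_le hpq
  have hx₀ := hq₀.trans_le hqx
  have hq₁ := hqx.trans_lt hx₁
  have hp₁ := hpq.trans_lt hq₁
  have hq := sub_pos.2 hq₁
  have hp := sub_pos.2 hp₁
  have hlog : Real.log (q * (1 - p) / (p * (1 - q))) ≤ (q - p) / (p * (1 - q)) := by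
    refine (Real.log_le_sub_one_of_pos (by positivity)).trans_eq ?_
    field_simp
    ring
  have := mul_le_mul_of_nonneg_left hlog (sub_nonneg.2 hqx)
  have := klBer_le_sq_div hx₀ hx₁ hq₀ hq₁
  rw [klBer_eq_add hx₀ hx₁ hq₀ hq₁ hp₀ hp₁]
  linarith

lemma factorial_le_stirling {n : ℕ} (hn : n ≠ 0) :
    (n.factorial : ℝ) ≤ Real.exp 1 * √n * (n / Real.exp 1) ^ n := by
  obtain ⟨k, rfl⟩ := Nat.exists_eq_succ_of_ne_zero hn
  have h := Stirling.stirlingSeq'_antitone (Nat.zero_le k)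
  simp only [Function.comp_apply, Nat.succ_eq_add_one, zero_add, Stirling.stirlingSeq_one] at h
  rw [Stirling.stirlingSeq, div_le_iff₀ (by positivity)] at h
  refine h.trans_eq ?_
  rw [Real.sqrt_mul zero_le_two]
  field_simp

lemma binPMF_nonneg {m : ℕ} {p : ℝ} (hp₀ : 0 ≤ p) (hp₁ : p ≤ 1) (j : ℕ) : 0 ≤ binPMF m p j := by
  have := sub_nonneg.2 hp₁
  unfold binPMF
  positivity

lemma binPMF_mul_factorial {m j : ℕ} (hjm : j ≤ m) (p : ℝ) :
    binPMF m p j * (j.factorial * (m - j).factorial) =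
      m.factorial * (p ^ j * (1 - p) ^ (m - j)) := by
  rw [← Nat.choose_mul_factorial_mul_factorial hjm]
  push_cast
  unfold binPMF
  ring

lemma stirling_mul_exp_neg_klBer {m j : ℕ} (hj : 0 < j) (hjm : j < m) {p : ℝ} (hp₀ : 0 < p)
    (hp₁ : p < 1) :
    ((j : ℝ) / Real.exp 1) ^ j * (((m - j : ℕ) : ℝ) / Real.exp 1) ^ (m - j) *
        Real.exp (-(m : ℝ) * klBer (j / m) p) =
      ((m : ℝ) / Real.exp 1) ^ m * (p ^ j * (1 - p) ^ (m - j)) := by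
  obtain ⟨l, rfl⟩ := Nat.exists_eq_add_of_le hjm.le
  have hl : 0 < l := by omega
  rw [Nat.add_sub_cancel_left]
  have hp := sub_pos.2 hp₁
  have hjR : (0 : ℝ) < j := mod_cast hj
  have hlR : (0 : ℝ) < l := mod_cast hl
  have hexp : Real.exp (-((j + l : ℕ) : ℝ) * klBer (j / (j + l : ℕ)) p) =
      (p * (j + l) / j) ^ j * ((1 - p) * (j + l) / l) ^ l := by
    rw [← Real.exp_log (show 0 < (p * (j + l) / j : ℝ) by positivity),
      ← Real.exp_log (show 0 < ((1 - p) * (j + l) / l : ℝ) by positivity),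
      ← Real.exp_nat_mul, ← Real.exp_nat_mul, ← Real.exp_add]
    congr 1
    have hcompl : 1 - (j : ℝ) / (j + l) = l / (j + l) := by field_simp; ring
    have e₁ : (p * (j + l) / j : ℝ) = (j / (j + l) / p)⁻¹ := by field_simp
    have e₂ : ((1 - p) * (j + l) / l : ℝ) = (l / (j + l) / (1 - p))⁻¹ := by field_simp
    rw [e₁, e₂, Real.log_inv, Real.log_inv]
    unfold klBer
    push_cast
    rw [hcompl]
    field_simp
    ring
  rw [hexp]
  push_cast
  simp only [div_pow, mul_pow, pow_add]
  field_simp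

lemma binPMF_le_exp_neg_klBer {m j : ℕ} (hj : 0 < j) (hjm : j < m) {p : ℝ} (hp₀ : 0 < p)
    (hp₁ : p < 1) :
    binPMF m p j * (2 * Real.pi * (√j * √(m - j : ℕ))) ≤
      Real.exp 1 * √m * Real.exp (-(m : ℝ) * klBer (j / m) p) := by
  have hp := sub_pos.2 hp₁
  have hl : 0 < m - j := by omega
  have hjR : (0 : ℝ) < j := mod_cast hj
  have hlR : (0 : ℝ) < (m - j : ℕ) := mod_cast hl
  have h₁ := Stirling.le_factorial_stirling j
  have h₂ := Stirling.le_factorial_stirling (m - j)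
  have h₃ := factorial_le_stirling (show m ≠ 0 by omega)
  have hE := stirling_mul_exp_neg_klBer hj hjm hp₀ hp₁
  have hF := binPMF_mul_factorial hjm.le p
  have hP := binPMF_nonneg (m := m) hp₀.le hp₁.le j
  have hpi : √(2 * Real.pi) * √(2 * Real.pi) = 2 * Real.pi := Real.mul_self_sqrt (by positivity)
  rw [Real.sqrt_mul (by positivity)] at h₁ h₂
  set A := ((j : ℝ) / Real.exp 1) ^ j
  set B := (((m - j : ℕ) : ℝ) / Real.exp 1) ^ (m - j)
  have hA : 0 < A := by positivity
  have hB : 0 < B := by positivity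
  refine le_of_mul_le_mul_right ?_ (mul_pos hA hB)
  calc _ = binPMF m p j * ((√(2 * Real.pi) * √j * A) * (√(2 * Real.pi) * √(m - j : ℕ) * B)) := by
        linear_combination -binPMF m p j * √j * √(m - j : ℕ) * A * B * hpi
    _ ≤ binPMF m p j * (j.factorial * (m - j).factorial) := by gcongr
    _ = m.factorial * (p ^ j * (1 - p) ^ (m - j)) := hF
    _ ≤ (Real.exp 1 * √m * (m / Real.exp 1) ^ m) * (p ^ j * (1 - p) ^ (m - j)) := by gcongr
    _ = _ := by rw [mul_assoc, ← hE]; ring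

lemma exp_neg_klBer_le_binPMF {m j : ℕ} (hj : 0 < j) (hjm : j < m) {p : ℝ} (hp₀ : 0 < p)
    (hp₁ : p < 1) :
    √(2 * Real.pi) * √m * Real.exp (-(m : ℝ) * klBer (j / m) p) ≤
      binPMF m p j * (Real.exp 1 ^ 2 * (√j * √(m - j : ℕ))) := by
  have hp := sub_pos.2 hp₁
  have hl : 0 < m - j := by omega
  have hjR : (0 : ℝ) < j := mod_cast hj
  have hlR : (0 : ℝ) < (m - j : ℕ) := mod_cast hl
  have h₁ := factorial_le_stirling hj.ne'
  have h₂ := factorial_le_stirling hl.ne'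
  have h₃ := Stirling.le_factorial_stirling m
  have hE := stirling_mul_exp_neg_klBer hj hjm hp₀ hp₁
  have hF := binPMF_mul_factorial hjm.le p
  have hP := binPMF_nonneg (m := m) hp₀.le hp₁.le j
  rw [Real.sqrt_mul (by positivity)] at h₃
  set A := ((j : ℝ) / Real.exp 1) ^ j
  set B := (((m - j : ℕ) : ℝ) / Real.exp 1) ^ (m - j)
  have hA : 0 < A := by positivity
  have hB : 0 < B := by positivity
  refine le_of_mul_le_mul_right ?_ (mul_pos hA hB)
  calc _ = (√(2 * Real.pi) * √m * (m / Real.exp 1) ^ m) * (p ^ j * (1 - p) ^ (m - j)) := by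
        rw [mul_assoc _ _ (p ^ j * _), ← hE]; ring
    _ ≤ m.factorial * (p ^ j * (1 - p) ^ (m - j)) := by gcongr
    _ = binPMF m p j * (j.factorial * (m - j).factorial) := hF.symm
    _ ≤ binPMF m p j * ((Real.exp 1 * √j * A) * (Real.exp 1 * √(m - j : ℕ) * B)) := by gcongr
    _ = _ := by ring

lemma succ_mul_binPMF_succ {m j : ℕ} (hjm : j ≤ m) (p : ℝ) :
    ((j : ℝ) + 1) * (1 - p) * binPMF m p (j + 1) = (m - j) * p * binPMF m p j := by
  have h : (m.choose (j + 1) : ℝ) * (j + 1) = m.choose j * (m - j) := by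
    have := Nat.choose_succ_right_eq m j
    rw [← Nat.cast_sub hjm]
    exact_mod_cast this
  rcases hjm.eq_or_lt with rfl | hlt
  · simp [binPMF]
  · obtain ⟨l, hl⟩ : ∃ l, m - j = l + 1 := ⟨m - j - 1, by omega⟩
    have hl' : m - (j + 1) = l := by omega
    unfold binPMF
    rw [hl, hl']
    linear_combination p ^ (j + 1) * (1 - p) ^ (l + 1) * h

/-- Telescoping form of the truncated first central moment of a binomial distribution. -/
lemma sum_Ico_sub_mul_binPMF {m k : ℕ} (hk : k ≤ m + 1) (p : ℝ) :
    ∑ j ∈ Finset.Ico k (m + 1), ((j : ℝ) - m * p) * binPMF m p j =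
      k * (1 - p) * binPMF m p k := by
  have key : ∀ n, k ≤ n → n ≤ m + 1 →
      ∑ j ∈ Finset.Ico k n, ((j : ℝ) - m * p) * binPMF m p j =
        k * (1 - p) * binPMF m p k - n * (1 - p) * binPMF m p n := by
    intro n hn
    induction n, hn using Nat.le_induction with
    | base => simp
    | succ n hn ih =>
      intro hnm
      rw [Finset.sum_Ico_succ_top hn, ih (by omega)]
      have := succ_mul_binPMF_succ (show n ≤ m by omega) p
      push_cast
      linear_combination this
  rw [key _ hk le_rfl]
  simp [binPMF]

lemma sum_Ico_binPMF_mul_le {m k : ℕ} (hk : k ≤ m + 1) {p : ℝ} (hp₀ : 0 ≤ p) (hp₁ : p ≤ 1) :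
    (∑ j ∈ Finset.Ico k (m + 1), binPMF m p j) * (k - m * p) ≤ k * (1 - p) * binPMF m p k := by
  rw [← sum_Ico_sub_mul_binPMF hk, Finset.sum_mul]
  refine Finset.sum_le_sum fun j hj ↦ ?_
  have : (k : ℝ) ≤ j := mod_cast (Finset.mem_Ico.1 hj).1
  nlinarith [binPMF_nonneg (m := m) hp₀ hp₁ j]

lemma sum_range_ite_le_eq_sum_Ico (n : ℕ) (t : ℝ) (f : ℕ → ℝ) :
    (∑ j ∈ Finset.range n, if t ≤ (j : ℝ) then f j else 0) = ∑ j ∈ Finset.Ico ⌈t⌉₊ n, f j := by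
  rw [← Finset.sum_filter]
  congr 1
  ext j
  simp [and_comm]

lemma sixteen_le_and_sqrt_mul_eq_one {m Δ : ℝ} (hΔ₀ : 0 < Δ) (hΔ₁ : Δ ≤ 1 / 4)
    (hm : m * Δ ^ 2 = 1) : 16 ≤ m ∧ √m * Δ = 1 := by
  have hm' : m = (1 / Δ) ^ 2 := by
    field_simp
    exact hm
  have h4 : 4 ≤ 1 / Δ := by
    rw [le_div_iff₀ hΔ₀]
    linarith
  rw [hm', Real.sqrt_sq (by positivity)]
  exact ⟨by nlinarith, by field_simp⟩

lemma sum_Ico_binPMF_le {m : ℕ} {Δ u : ℝ} (hΔ₀ : 0 < Δ) (hΔ₁ : Δ ≤ 1 / 4)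
    (hm : (m : ℝ) * Δ ^ 2 = 1) (hu₀ : 2 ≤ u) (hu₁ : u * Δ ≤ 1 / 2) :
    ∑ j ∈ Finset.Ico ⌈(m : ℝ) * ((1 + u * Δ) / 2)⌉₊ (m + 1), binPMF m ((1 - Δ) / 2) j ≤
      2 / (1 + u) * Real.exp (-(m : ℝ) * klBer ((1 + u * Δ) / 2) ((1 - Δ) / 2)) := by
  obtain ⟨hm16, hsm⟩ := sixteen_le_and_sqrt_mul_eq_one hΔ₀ hΔ₁ hm
  have huΔ : 0 < u * Δ := by positivity
  set q := (1 + u * Δ) / 2 with hq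
  set p := (1 - Δ) / 2 with hp
  set k := ⌈(m : ℝ) * q⌉₊
  have hqk : m * q ≤ k := Nat.le_ceil _
  have hkq : (k : ℝ) < m * q + 1 := Nat.ceil_lt_add_one (by positivity)
  have hkm9 : (k : ℝ) ≤ 9 * (m - k) := by nlinarith
  have hk₀ : (0 : ℝ) < k := by nlinarith
  have hkm : (k : ℝ) < m := by linarith
  have hk₀' : 0 < k := mod_cast hk₀
  have hkm' : k < m := mod_cast hkm
  have hp₀ : 0 < p := by linarith
  have hp₁ : p < 1 := by linarith
  have hkl : klBer q p ≤ klBer (k / m) p := by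
    refine klBer_le_of_le hp₀ (by linarith) ?_ ?_
    · rw [le_div_iff₀ (by linarith)]; linarith
    · rw [div_lt_one (by linarith)]; exact hkm
  have hexp : Real.exp (-(m : ℝ) * klBer (k / m) p) ≤ Real.exp (-(m : ℝ) * klBer q p) := by
    apply Real.exp_le_exp.2
    nlinarith
  have htail := sum_Ico_binPMF_mul_le (show k ≤ m + 1 by omega) hp₀.le hp₁.le
  have hpmf := binPMF_le_exp_neg_klBer hk₀' hkm' hp₀ hp₁
  have hsqrt : √k ≤ 3 * √(m - k : ℕ) := by
    rw [Nat.cast_sub hkm'.le, show (3 : ℝ) = √9 by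
      rw [show (9 : ℝ) = 3 ^ 2 by norm_num, Real.sqrt_sq (by norm_num)],
      ← Real.sqrt_mul (by norm_num)]
    exact Real.sqrt_le_sqrt hkm9
  have hT : 0 ≤ ∑ j ∈ Finset.Ico k (m + 1), binPMF m p j :=
    Finset.sum_nonneg fun j _ ↦ binPMF_nonneg hp₀.le hp₁.le j
  have hP := binPMF_nonneg (m := m) hp₀.le hp₁.le k
  set T := ∑ j ∈ Finset.Ico k (m + 1), binPMF m p j
  set P := binPMF m p k
  set E := Real.exp (-(m : ℝ) * klBer q p)
  have hE : 0 < E := Real.exp_pos _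
  have hk2 : (k : ℝ) = √k * √k := (Real.mul_self_sqrt hk₀.le).symm
  have hsk : 0 < √(k : ℝ) := Real.sqrt_pos.2 hk₀
  have hsl : 0 < √((m - k : ℕ) : ℝ) := by linarith
  have hgap : (1 + u) / 2 ≤ (k - m * p) * Δ := by
    have : m * (q - p) * Δ = (1 + u) / 2 := by
      rw [hq, hp]; linear_combination (1 + u) / 2 * hm
    nlinarith
  have h₁ : T * ((1 + u) / 2) ≤ k * (1 - p) * P * Δ := by
    calc T * ((1 + u) / 2) ≤ T * ((k - m * p) * Δ) := by gcongr
      _ = T * (k - m * p) * Δ := by ring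
      _ ≤ _ := by gcongr
  have h₂ : P * Δ * (√k * √(m - k : ℕ)) ≤ E / 2 := by
    have hpi := Real.pi_gt_three
    have he := Real.exp_one_lt_three
    have h : P * (2 * Real.pi * (√k * √(m - k : ℕ))) * Δ ≤ Real.exp 1 * √m * E * Δ := by
      refine mul_le_mul_of_nonneg_right ?_ hΔ₀.le
      exact hpmf.trans (by gcongr)
    have h' : Real.exp 1 * √m * E * Δ = Real.exp 1 * E := by
      linear_combination Real.exp 1 * E * hsm
    rw [h'] at h
    have h₃ : Real.exp 1 * E ≤ 3 * E := by gcongr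
    have h₄ : P * Δ * (√k * √(m - k : ℕ)) * 3 ≤ P * Δ * (√k * √(m - k : ℕ)) * Real.pi := by gcongr
    linarith
  have h₃ : k * (1 - p) * P * Δ ≤ E := by
    have h1p : 1 - p ≤ 5 / 8 := by linarith
    calc k * (1 - p) * P * Δ = P * Δ * √k * √k * (1 - p) := by
          linear_combination (1 - p) * P * Δ * hk2
      _ ≤ P * Δ * √k * (3 * √(m - k : ℕ)) * (5 / 8) := by gcongr
      _ ≤ E := by linarith
  rw [div_mul_eq_mul_div, le_div_iff₀ (by linarith)]
  linarith

/-- A KL perturbation bound within `D` lattice points of the mean `m * q`. -/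
lemma mul_klBer_le_add_five {m x q p Δ D : ℝ} (hm₀ : 0 < m) (hm : m * Δ ^ 2 = 1) (hΔ₀ : 0 < Δ)
    (hp : 1 / 2 ≤ p) (hpq : p ≤ q) (hq : q ≤ 3 / 4) (hqx : q ≤ x) (hx₁ : x < 1)
    (hxD : m * (x - q) ≤ D) (hDq : D * (q - p) ≤ 1 / 2) (hDΔ : D * Δ ≤ 1 / 3) :
    m * klBer x p ≤ m * klBer q p + 5 := by
  have h := klBer_le_add (by linarith) hpq hqx hx₁
  set y := x - q
  have hy₀ : 0 ≤ y := sub_nonneg.2 hqx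
  have hqp : 0 ≤ q - p := sub_nonneg.2 hpq
  have hden₁ : 1 / 8 ≤ p * (1 - q) := by nlinarith
  have hden₂ : 1 / 8 ≤ q * (1 - q) := by nlinarith
  have hb₁ : (q - p) / (p * (1 - q)) ≤ 8 * (q - p) := by
    rw [div_le_iff₀ (by linarith)]
    nlinarith
  have hb₂ : y ^ 2 / (q * (1 - q)) ≤ 8 * y ^ 2 := by
    rw [div_le_iff₀ (by linarith)]
    nlinarith [sq_nonneg y]
  have hc₁ : m * y * (8 * (q - p)) ≤ 4 := by
    calc m * y * (8 * (q - p)) ≤ D * (8 * (q - p)) := by gcongr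
      _ ≤ 4 := by linarith
  have hc₂ : m * (8 * y ^ 2) ≤ 1 := by
    have h₁ : m * (8 * y ^ 2) = 8 * (m * y * Δ) ^ 2 := by
      linear_combination -8 * m * y ^ 2 * hm
    have h₂ : m * y * Δ ≤ D * Δ := by gcongr
    have h₃ : 0 ≤ m * y * Δ := by positivity
    rw [h₁]
    nlinarith
  calc m * klBer x p ≤ m * (klBer q p + y * (8 * (q - p)) + 8 * y ^ 2) := by
        gcongr
        exact h.trans (by gcongr)
    _ ≤ _ := by linarith

lemma two_mul_sqrt_mul_exp_le_binPMF {m j : ℕ} (hj : 0 < j) (hjm : j < m) {p : ℝ} (hp₀ : 0 < p)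
    (hp₁ : p < 1) :
    2 * √m * Real.exp (-(m : ℝ) * klBer (j / m) p) ≤ binPMF m p j * (9 * m) := by
  have hP := binPMF_nonneg (m := m) hp₀.le hp₁.le j
  have hpi : 2 ≤ √(2 * Real.pi) := Real.le_sqrt_of_sq_le (by linarith [Real.pi_gt_three])
  have he : Real.exp 1 ^ 2 ≤ 9 := by
    nlinarith [Real.exp_one_lt_three, Real.exp_pos 1]
  have hs : √j * √(m - j : ℕ) ≤ m := by
    calc √(j : ℝ) * √(m - j : ℕ) ≤ √m * √m := by
          gcongr
          omega
      _ = m := Real.mul_self_sqrt (Nat.cast_nonneg m)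
  calc _ ≤ √(2 * Real.pi) * √m * Real.exp (-(m : ℝ) * klBer (j / m) p) := by gcongr
    _ ≤ _ := exp_neg_klBer_le_binPMF hj hjm hp₀ hp₁
    _ ≤ _ := by gcongr

lemma le_sum_Ico_binPMF {m : ℕ} {Δ u : ℝ} (hΔ₀ : 0 < Δ) (hΔ₁ : Δ ≤ 1 / 4)
    (hm : (m : ℝ) * Δ ^ 2 = 1) (hu₀ : 2 ≤ u) (hu₁ : u * Δ ≤ 1 / 2) :
    Real.exp (-5) / 9 / (1 + u) *
        Real.exp (-(m : ℝ) * klBer ((1 + u * Δ) / 2) ((1 + Δ) / 2)) ≤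
      ∑ j ∈ Finset.Ico ⌈(m : ℝ) * ((1 + u * Δ) / 2)⌉₊ (m + 1), binPMF m ((1 + Δ) / 2) j := by
  obtain ⟨hm16, hsm⟩ := sixteen_le_and_sqrt_mul_eq_one hΔ₀ hΔ₁ hm
  have hm₀ : (0 : ℝ) < m := by linarith
  have huΔ : 0 < u * Δ := by positivity
  have hu : 0 < 1 + u := by linarith
  set q := (1 + u * Δ) / 2 with hq
  set p := (1 + Δ) / 2 with hp
  set k := ⌈(m : ℝ) * q⌉₊
  have hqk : m * q ≤ k := Nat.le_ceil _
  have hkq : (k : ℝ) < m * q + 1 := Nat.ceil_lt_add_one (by positivity)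
  have hp₀ : 0 < p := by linarith
  have hp₁ : p < 1 := by linarith
  have hpq : p ≤ q := by rw [hp, hq]; nlinarith
  set D := 1 / ((1 + u) * Δ) with hD
  have hD₀ : 0 < D := by positivity
  have hDu : D * ((1 + u) * Δ) = 1 := by rw [hD]; field_simp
  have hD₁ : 1 ≤ D := by rw [hD, le_div_iff₀ (by positivity)]; linarith
  have hDΔ : D * Δ ≤ 1 / 3 := by nlinarith [mul_pos hD₀ hΔ₀]
  have hDq : D * (q - p) ≤ 1 / 2 := by
    rw [hp, hq]
    linarith [mul_pos hD₀ hΔ₀]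
  have hDm : D ≤ m / 12 := by
    have : m * Δ * Δ = 1 := by linear_combination hm
    have h4 : 4 ≤ m * Δ := by nlinarith
    have hmD : D = D * Δ * (m * Δ) := by linear_combination -D * hm
    nlinarith
  have hmq₀ : 0 < m * q := by positivity
  have hmq₁ : m * q ≤ m * (3 / 4) := by
    gcongr
    linarith
  set n := ⌊D⌋₊
  have hnD : (n : ℝ) ≤ D := Nat.floor_le hD₀.le
  have hDn : D < n + 1 := Nat.lt_floor_add_one D
  have hn₁ : (1 : ℝ) ≤ n := mod_cast Nat.one_le_floor_iff D |>.2 hD₁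
  set E := Real.exp (-(m : ℝ) * klBer q p)
  have hE : 0 < E := Real.exp_pos _
  have hterm : ∀ j ∈ Finset.Ico k (k + n), j < m ∧
      2 / 9 * Δ * (Real.exp (-5) * E) ≤ binPMF m p j := by
    intro j hj
    rw [Finset.mem_Ico] at hj
    have hkj : (k : ℝ) ≤ j := mod_cast hj.1
    have hjk : (j : ℝ) + 1 ≤ k + n := mod_cast hj.2
    have hjD : j - m * q ≤ D := by linarith
    have hjm : (j : ℝ) < m := by linarith
    have hj₀ : (0 : ℝ) < j := by linarith
    have hjm' : j < m := mod_cast hjm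
    have hj₀' : 0 < j := mod_cast hj₀
    refine ⟨hjm', ?_⟩
    have hkl : m * klBer (j / m) p ≤ m * klBer q p + 5 := by
      refine mul_klBer_le_add_five hm₀ hm hΔ₀ (by linarith) hpq (by linarith) ?_ ?_ ?_ hDq hDΔ
      · rw [le_div_iff₀ hm₀]
        linarith
      · rwa [div_lt_one hm₀]
      · rwa [mul_sub, mul_div_cancel₀ _ hm₀.ne']
    have hexp : Real.exp (-5) * E ≤ Real.exp (-(m : ℝ) * klBer (j / m) p) := by
      rw [← Real.exp_add]
      apply Real.exp_le_exp.2
      linarith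
    have h : 2 * √m * (Real.exp (-5) * E) ≤ binPMF m p j * (9 * m) :=
      (by gcongr : _ ≤ _).trans (two_mul_sqrt_mul_exp_le_binPMF hj₀' hjm' hp₀ hp₁)
    have h' := mul_le_mul_of_nonneg_right h (sq_nonneg Δ)
    have e₁ : 2 * √m * (Real.exp (-5) * E) * Δ ^ 2 = 2 * Δ * (Real.exp (-5) * E) := by
      linear_combination 2 * Δ * (Real.exp (-5) * E) * hsm
    have e₂ : binPMF m p j * (9 * m) * Δ ^ 2 = 9 * binPMF m p j := by
      linear_combination 9 * binPMF m p j * hm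
    linarith
  have hsub : Finset.Ico k (k + n) ⊆ Finset.Ico k (m + 1) := by
    intro j hj
    have := (hterm j hj).1
    rw [Finset.mem_Ico] at hj ⊢
    omega
  calc Real.exp (-5) / 9 / (1 + u) * E = D / 2 * (2 / 9 * Δ * (Real.exp (-5) * E)) := by
        rw [hD]; field_simp
    _ ≤ n * (2 / 9 * Δ * (Real.exp (-5) * E)) := by gcongr; linarith
    _ = ∑ j ∈ Finset.Ico k (k + n), 2 / 9 * Δ * (Real.exp (-5) * E) := by simp
    _ ≤ ∑ j ∈ Finset.Ico k (k + n), binPMF m p j := Finset.sum_le_sum fun j hj ↦ (hterm j hj).2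
    _ ≤ ∑ j ∈ Finset.Ico k (m + 1), binPMF m p j :=
      Finset.sum_le_sum_of_subset_of_nonneg hsub fun j _ _ ↦ binPMF_nonneg hp₀.le hp₁.le j

/-- Binomial tail bounds: there is a universal `c > 0` such that for every `Δ ∈ (0, 1/4]`
with `m := 1/Δ²` a positive integer and every `u ∈ [2, 1/(2Δ)]`, with
`X ~ Bin(m, (1-Δ)/2)` and `Y ~ Bin(m, (1+Δ)/2)`:
(i)  `P(X ≥ (1+uΔ)/(2Δ²)) ≤ (2/(1+u)) exp(-m KL(Ber((1-uΔ)/2) ‖ Ber((1+Δ)/2)))`, and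
(ii) `P(Y ≥ (1+uΔ)/(2Δ²)) ≥ (c/(1+u)) exp(-m KL(Ber((1-uΔ)/2) ‖ Ber((1-Δ)/2)))`. -/
theorem binomial_tail_bounds :
    ∃ c : ℝ, 0 < c ∧
      ∀ Δ : ℝ, 0 < Δ → Δ ≤ 1 / 4 →
        ∀ m : ℕ, 1 ≤ m → (m : ℝ) = 1 / Δ ^ 2 →
          ∀ u : ℝ, 2 ≤ u → u ≤ 1 / (2 * Δ) →
            (∑ j ∈ Finset.range (m + 1),
                if (1 + u * Δ) / (2 * Δ ^ 2) ≤ (j : ℝ) then binPMF m ((1 - Δ) / 2) j else 0)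
              ≤ 2 / (1 + u) * Real.exp (-(m : ℝ) * klBer ((1 - u * Δ) / 2) ((1 + Δ) / 2)) ∧
            c / (1 + u) * Real.exp (-(m : ℝ) * klBer ((1 - u * Δ) / 2) ((1 - Δ) / 2))
              ≤ ∑ j ∈ Finset.range (m + 1),
                  if (1 + u * Δ) / (2 * Δ ^ 2) ≤ (j : ℝ) then binPMF m ((1 + Δ) / 2) j else 0 := by
  refine ⟨Real.exp (-5) / 9, by positivity, ?_⟩
  intro Δ hΔ₀ hΔ₁ m _ hm u hu₀ hu₁
  have hmΔ : (m : ℝ) * Δ ^ 2 = 1 := by rw [hm]; field_simp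
  have huΔ : u * Δ ≤ 1 / 2 := by
    rw [le_div_iff₀ (by positivity)] at hu₁
    linarith
  have ht : (1 + u * Δ) / (2 * Δ ^ 2) = m * ((1 + u * Δ) / 2) := by rw [hm]; field_simp
  have e₁ : (1 - u * Δ) / 2 = 1 - (1 + u * Δ) / 2 := by ring
  have e₂ : (1 + Δ) / 2 = 1 - (1 - Δ) / 2 := by ring
  have e₃ : (1 - Δ) / 2 = 1 - (1 + Δ) / 2 := by ring
  have hkl₁ : klBer ((1 - u * Δ) / 2) ((1 + Δ) / 2) = klBer ((1 + u * Δ) / 2) ((1 - Δ) / 2) := by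
    rw [e₁, e₂, klBer_one_sub]
  have hkl₂ : klBer ((1 - u * Δ) / 2) ((1 - Δ) / 2) = klBer ((1 + u * Δ) / 2) ((1 + Δ) / 2) := by
    rw [e₁, e₃, klBer_one_sub]
  rw [sum_range_ite_le_eq_sum_Ico, sum_range_ite_le_eq_sum_Ico, ht, hkl₁, hkl₂]
  exact ⟨sum_Ico_binPMF_le hΔ₀ hΔ₁ hmΔ hu₀ huΔ, le_sum_Ico_binPMF hΔ₀ hΔ₁ hmΔ hu₀ huΔ⟩
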